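/- arXiv:1507.03549 — 2 statements merged into one kernel-verified Lean document; each statement's English description precedes it below -/
import Mathlib

section
/- Let Z ∈ D be a minimizer of f over D and let X ∈ D satisfy ‖X - Z‖_X < 1. Then the Newton step satisfies ‖N(X)‖_X ≤ ‖X - Z‖_X / (1 - ‖X - Z‖_X). -/
/-- The local (intrinsic) norm `‖V‖_W = (tr(W⁻¹ V W⁻¹ V))^{1/2}` of a symmetric matrix `V`
at a positive definite matrix `W`, coming from the Hessian of the barrier `-ln det`. -/
noncomputable def localNorm {n : ℕ} (W V : Matrix (Fin n) (Fin n) ℝ) : ℝ :=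
  Real.sqrt ((W⁻¹ * V * W⁻¹ * V).trace)

/-- The barrier `f(X) = -ln det X`. -/
noncomputable def barrier {n : ℕ} (X : Matrix (Fin n) (Fin n) ℝ) : ℝ :=
  -Real.log X.det

/-- The domain `D = {X : X ≻ 0, X - X₀ ∈ L}` of the barrier restricted to the affine
slice `X₀ + L`. -/
def barrierDomain {n : ℕ} (L : Submodule ℝ (Matrix (Fin n) (Fin n) ℝ))
    (X₀ : Matrix (Fin n) (Fin n) ℝ) : Set (Matrix (Fin n) (Fin n) ℝ) :=
  {X | X.PosDef ∧ X - X₀ ∈ L}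


/-- A small multiple of a symmetric matrix is a positive definite perturbation of the identity. -/
theorem eventually_posDef_one_add_smul {n : ℕ} {M : Matrix (Fin n) (Fin n) ℝ}
    (hM : M.IsHermitian) : ∀ᶠ t : ℝ in nhds 0, (1 + t • M).PosDef := by
  have hlim (i : Fin n) : ∀ᶠ t : ℝ in nhds 0, 0 < 1 + t * hM.eigenvalues i := by
    have h : Continuous fun t : ℝ => 1 + t * hM.eigenvalues i := by fun_prop
    exact h.tendsto 0 |>.eventually_const_lt (by simp)
  filter_upwards [Filter.eventually_all.2 hlim] with t ht
  have h := (Matrix.IsUnit.posDef_star_right_conjugate_iff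
    (Unitary.isUnit_coe (U := hM.eigenvectorUnitary))).2 (Matrix.PosDef.diagonal ht)
  convert h using 1
  have hd : Matrix.diagonal (fun i => 1 + t * hM.eigenvalues i) =
      1 + t • Matrix.diagonal hM.eigenvalues := by
    ext i j
    by_cases hij : i = j <;> simp [hij]
  rw [hd, Matrix.mul_add, Matrix.add_mul, Matrix.mul_one, Unitary.mul_star_self_of_mem hM.eigenvectorUnitary.2,
    Matrix.mul_smul, Matrix.smul_mul]
  conv_lhs => rw [hM.spectral_theorem, Unitary.conjStarAlgAut_apply]
  rfl

section Factorization

open scoped MatrixOrder Matrix.Norms.L2Operator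

/-- A positive definite matrix factors as `Rᵀ R` with `R` invertible. -/
theorem Matrix.PosDef.exists_isUnit_transpose_mul_self {n : ℕ} {W : Matrix (Fin n) (Fin n) ℝ}
    (hW : W.PosDef) : ∃ R : Matrix (Fin n) (Fin n) ℝ, IsUnit R ∧ W = R.transpose * R := by
  obtain ⟨R, hR, h⟩ :=
    CStarAlgebra.isStrictlyPositive_iff_eq_star_mul_self.1 hW.isStrictlyPositive
  exact ⟨R, hR, by simpa [Matrix.star_eq_conjTranspose] using h⟩

end Factorization

/-- Positive definiteness is an open condition along symmetric directions. -/
theorem Matrix.PosDef.eventually_add_smul {n : ℕ} {Z Y : Matrix (Fin n) (Fin n) ℝ}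
    (hZ : Z.PosDef) (hY : Y.IsSymm) : ∀ᶠ t : ℝ in nhds 0, (Z + t • Y).PosDef := by
  obtain ⟨R, hR, rfl⟩ := hZ.exists_isUnit_transpose_mul_self
  have hdet : IsUnit R.det := (Matrix.isUnit_iff_isUnit_det R).1 hR
  have hdetT : IsUnit R.transpose.det := by rwa [Matrix.det_transpose]
  have hsymm : (R⁻¹.transpose * Y * R⁻¹).IsHermitian := by
    simp [Matrix.IsHermitian, Matrix.transpose_mul, hY.eq, Matrix.mul_assoc]
  filter_upwards [eventually_posDef_one_add_smul hsymm] with t ht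
  have h := (Matrix.IsUnit.posDef_star_left_conjugate_iff hR).2 ht
  convert h using 1
  simp only [Matrix.star_eq_conjTranspose, Matrix.conjTranspose_eq_transpose_of_trivial,
    Matrix.mul_add, Matrix.add_mul, Matrix.mul_one, Matrix.mul_smul, Matrix.smul_mul,
    Matrix.transpose_nonsing_inv]
  rw [Matrix.mul_assoc R.transpose⁻¹, Matrix.mul_nonsing_inv_cancel_left _ _ hdetT,
    Matrix.nonsing_inv_mul_cancel_right _ _ hdet]

/-- The derivative of `t ↦ det (1 + t Q)` at `0` is the trace of `Q`. -/
theorem hasDerivAt_det_one_add_smul {n : ℕ} (Q : Matrix (Fin n) (Fin n) ℝ) :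
    HasDerivAt (fun t : ℝ => (1 + t • Q).det) Q.trace 0 := by
  have h := (Matrix.det (1 + (Polynomial.X : Polynomial ℝ) • Q.map Polynomial.C)).hasDerivAt 0
  rw [Matrix.derivative_det_one_add_X_smul] at h
  refine h.congr_of_eventuallyEq (.of_forall fun t => ?_)
  simp [eval_det, ← Matrix.smul_eq_mul_diagonal]

/-- First-order optimality: at a minimizer of the barrier the gradient `-Z⁻¹` is orthogonal
to the feasible directions. -/
theorem trace_inv_mul_eq_zero_of_barrier_min {n : ℕ}
    {L : Submodule ℝ (Matrix (Fin n) (Fin n) ℝ)} {X₀ Z Y : Matrix (Fin n) (Fin n) ℝ}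
    (hZ : Z ∈ barrierDomain L X₀) (hZmin : ∀ W ∈ barrierDomain L X₀, barrier Z ≤ barrier W)
    (hY : Y ∈ L) (hYs : Y.IsSymm) : (Z⁻¹ * Y).trace = 0 := by
  refine IsLocalMax.hasDerivAt_eq_zero ?_ (hasDerivAt_det_one_add_smul (Z⁻¹ * Y))
  filter_upwards [hZ.1.eventually_add_smul hYs] with t ht
  have hmem : Z + t • Y ∈ barrierDomain L X₀ := by
    refine ⟨ht, ?_⟩
    rw [add_sub_right_comm]
    exact L.add_mem hZ.2 (L.smul_mem t hY)
  have hle : (Z + t • Y).det ≤ Z.det :=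
    (Real.log_le_log_iff ht.det_pos hZ.1.det_pos).1 (neg_le_neg_iff.1 (hZmin _ hmem))
  have hfac : Z + t • Y = Z * (1 + t • (Z⁻¹ * Y)) := by
    rw [Matrix.mul_add, Matrix.mul_one, Matrix.mul_smul,
      Matrix.mul_nonsing_inv_cancel_left _ _ hZ.1.det_pos.ne'.isUnit]
  rw [hfac, Matrix.det_mul] at hle
  simpa using le_of_mul_le_mul_left (hle.trans_eq (mul_one _).symm) hZ.1.det_pos

section Frobenius

open scoped Matrix.Norms.Frobenius

theorem Matrix.frobenius_norm_eq_sqrt_sum {n : ℕ} (B : Matrix (Fin n) (Fin n) ℝ) :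
    ‖B‖ = Real.sqrt (∑ i, ∑ j, B i j ^ 2) := by
  simp [Matrix.frobenius_norm_def, Real.sqrt_eq_rpow]

theorem Matrix.frobenius_norm_eq_sqrt_trace {n : ℕ} {B : Matrix (Fin n) (Fin n) ℝ}
    (hB : B.IsSymm) : ‖B‖ = Real.sqrt (B * B).trace := by
  rw [Matrix.frobenius_norm_eq_sqrt_sum]
  congr 1
  simp only [Matrix.trace, Matrix.diag, Matrix.mul_apply, pow_two]
  exact Finset.sum_congr rfl fun i _ => Finset.sum_congr rfl fun j _ => by rw [hB.apply i j]

/-- Cauchy-Schwarz for the trace pairing. -/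
theorem Matrix.abs_trace_mul_le_frobenius {n : ℕ} (B M : Matrix (Fin n) (Fin n) ℝ) :
    |(B * M).trace| ≤ ‖B‖ * ‖M‖ := by
  rw [← Matrix.frobenius_norm_transpose M, Matrix.frobenius_norm_eq_sqrt_sum,
    Matrix.frobenius_norm_eq_sqrt_sum, ← Real.sqrt_mul (by positivity)]
  apply Real.abs_le_sqrt
  simpa [Matrix.trace, Matrix.mul_apply, Fintype.sum_prod_type] using
    Finset.sum_mul_sq_le_sq_mul_sq (Finset.univ : Finset (Fin n × Fin n))
      (fun p => B p.1 p.2) (fun p => M.transpose p.1 p.2)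

/-- If `W⁻¹ = Tᵀ T` then the local norm at `W` is the Frobenius norm after congruence by `T`. -/
theorem localNorm_eq_frobenius_norm {n : ℕ} {W T V : Matrix (Fin n) (Fin n) ℝ}
    (hT : W⁻¹ = T.transpose * T) (hV : V.IsSymm) :
    localNorm W V = ‖T * V * T.transpose‖ := by
  have hs : (T * V * T.transpose).IsSymm := by
    simp [Matrix.IsSymm, Matrix.transpose_mul, hV.eq, Matrix.mul_assoc]
  rw [Matrix.frobenius_norm_eq_sqrt_trace hs, localNorm, hT]
  congr 1
  simp only [Matrix.mul_assoc]
  rw [Matrix.trace_mul_comm]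
  simp only [Matrix.mul_assoc]

/-- If `1 + B` is a right inverse of `1 - A` with `‖A‖ < 1`, then `‖B‖ ≤ ‖A‖ / (1 - ‖A‖)`. -/
theorem norm_le_div_of_one_sub_mul_one_add {R : Type*} [NormedRing R] {A B : R}
    (hA : ‖A‖ < 1) (h : (1 - A) * (1 + B) = 1) : ‖B‖ ≤ ‖A‖ / (1 - ‖A‖) := by
  have hB : B = A + A * B := by
    have h' : 1 + B - (A + A * B) = 1 := (by noncomm_ring : _ = (1 - A) * (1 + B)).trans h
    rw [add_sub_assoc, add_eq_left, sub_eq_zero] at h'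
    exact h'
  have hle : ‖B‖ ≤ ‖A‖ + ‖A‖ * ‖B‖ :=
    calc ‖B‖ = ‖A + A * B‖ := congrArg norm hB
      _ ≤ ‖A‖ + ‖A * B‖ := norm_add_le _ _
      _ ≤ ‖A‖ + ‖A‖ * ‖B‖ := by gcongr; exact norm_mul_le _ _
  rw [le_div_iff₀ (sub_pos.2 hA)]
  linarith

/-- The gradient difference `W⁻¹ - Z⁻¹` of the barrier, paired with a symmetric direction. -/
theorem trace_inv_sub_inv_mul_le {n : ℕ} {W Z V : Matrix (Fin n) (Fin n) ℝ}
    (hW : W.PosDef) (hZ : Z.PosDef) (hV : V.IsSymm) (hclose : localNorm W (W - Z) < 1) :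
    ((W⁻¹ - Z⁻¹) * V).trace ≤
      localNorm W (W - Z) / (1 - localNorm W (W - Z)) * localNorm W V := by
  obtain ⟨T, hT, hWT⟩ := hW.inv.exists_isUnit_transpose_mul_self
  have hTdet : IsUnit T.det := (Matrix.isUnit_iff_isUnit_det T).1 hT
  have hTdet' : IsUnit T.transpose.det := by rwa [Matrix.det_transpose]
  have hsymm : (W - Z).IsSymm := by
    simpa [Matrix.IsHermitian, Matrix.IsSymm] using hW.isHermitian.sub hZ.isHermitian
  rw [localNorm_eq_frobenius_norm hWT hsymm] at hclose ⊢
  rw [localNorm_eq_frobenius_norm hWT hV]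
  have hone : T * W * T.transpose = 1 := by
    have hWeq : W = T⁻¹ * T.transpose⁻¹ := by
      rw [← Matrix.mul_inv_rev, ← hWT,
        Matrix.nonsing_inv_nonsing_inv _ hW.det_pos.ne'.isUnit]
    rw [hWeq, Matrix.mul_nonsing_inv_cancel_left _ _ hTdet, Matrix.nonsing_inv_mul _ hTdet']
  set A := T * (W - Z) * T.transpose with hA
  set C := T.transpose⁻¹ * Z⁻¹ * T⁻¹ with hC
  have hsub : 1 - A = T * Z * T.transpose := by
    rw [hA, Matrix.mul_sub, Matrix.sub_mul, hone, sub_sub_cancel]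
  have hinv : (1 - A) * (1 + (C - 1)) = 1 := by
    rw [hsub, add_sub_cancel, hC]
    simp only [Matrix.mul_assoc]
    rw [Matrix.mul_nonsing_inv_cancel_left _ _ hTdet',
      Matrix.mul_nonsing_inv_cancel_left _ _ hZ.det_pos.ne'.isUnit, Matrix.mul_nonsing_inv _ hTdet]
  have htrace : ((W⁻¹ - Z⁻¹) * V).trace = -((C - 1) * (T * V * T.transpose)).trace := by
    have h₁ : (W⁻¹ * V).trace = (T * V * T.transpose).trace := by
      rw [hWT, Matrix.mul_assoc, Matrix.trace_mul_comm]
    have h₂ : (C * (T * V * T.transpose)).trace = (Z⁻¹ * V).trace := by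
      rw [hC]
      simp only [Matrix.mul_assoc]
      rw [Matrix.nonsing_inv_mul_cancel_left _ _ hTdet, Matrix.trace_mul_comm]
      simp only [Matrix.mul_assoc]
      rw [Matrix.mul_nonsing_inv _ hTdet', Matrix.mul_one]
    rw [Matrix.sub_mul, Matrix.sub_mul, Matrix.trace_sub, Matrix.trace_sub, h₁, h₂, Matrix.one_mul]
    ring
  rw [htrace]
  calc -((C - 1) * (T * V * T.transpose)).trace
      ≤ ‖C - 1‖ * ‖T * V * T.transpose‖ :=
        (neg_le_abs _).trans (Matrix.abs_trace_mul_le_frobenius _ _)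
    _ ≤ ‖A‖ / (1 - ‖A‖) * ‖T * V * T.transpose‖ := by
        gcongr
        exact norm_le_div_of_one_sub_mul_one_add hclose hinv

end Frobenius

theorem localNorm_sq {n : ℕ} {W V : Matrix (Fin n) (Fin n) ℝ} (hW : W.PosDef) (hV : V.IsSymm) :
    localNorm W V ^ 2 = (W⁻¹ * V * W⁻¹ * V).trace := by
  refine Real.sq_sqrt ?_
  obtain ⟨T, -, hT⟩ := hW.inv.exists_isUnit_transpose_mul_self
  have h₁ := (Matrix.posSemidef_conjTranspose_mul_self (T * V * T.transpose)).trace_nonneg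
  refine h₁.trans_eq (Eq.symm ?_)
  simp only [hT, Matrix.conjTranspose_eq_transpose_of_trivial, Matrix.transpose_mul, hV.eq,
    Matrix.transpose_transpose, Matrix.mul_assoc]
  rw [Matrix.trace_mul_comm T.transpose]
  simp only [Matrix.mul_assoc]

/-- Corollary to Renegar's Theorem 2.2.3 for the SDP barrier: if `Z` minimizes
`f = -ln det` over `D` and `X ∈ D` with `‖X - Z‖_X < 1`, then the Newton step `N` at `X`
(characterized by `π_L(X⁻¹ N X⁻¹) = π_L(X⁻¹)`) satisfies
`‖N‖_X ≤ ‖X - Z‖_X / (1 - ‖X - Z‖_X)`. -/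
theorem newton_step_norm_bound {n : ℕ}
    (L : Submodule ℝ (Matrix (Fin n) (Fin n) ℝ)) (hL : ∀ Y ∈ L, Y.IsSymm)
    (X₀ : Matrix (Fin n) (Fin n) ℝ) (hX₀ : X₀.PosDef)
    (Z : Matrix (Fin n) (Fin n) ℝ) (hZ : Z ∈ barrierDomain L X₀)
    (hZmin : ∀ W ∈ barrierDomain L X₀, barrier Z ≤ barrier W)
    (X : Matrix (Fin n) (Fin n) ℝ) (hXD : X ∈ barrierDomain L X₀)
    (N : Matrix (Fin n) (Fin n) ℝ) (hN : N ∈ L)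
    (hNewton : ∀ Y ∈ L, ((X⁻¹ * N * X⁻¹ - X⁻¹) * Y).trace = 0)
    (hclose : localNorm X (X - Z) < 1) :
    localNorm X N ≤ localNorm X (X - Z) / (1 - localNorm X (X - Z)) := by
  have hNs := hL N hN
  have hnewton : (X⁻¹ * N * X⁻¹ * N).trace = (X⁻¹ * N).trace := by
    have h := hNewton N hN
    rwa [Matrix.sub_mul, Matrix.trace_sub, sub_eq_zero] at h
  have hsq : localNorm X N ^ 2 = ((X⁻¹ - Z⁻¹) * N).trace := by
    rw [localNorm_sq hXD.1 hNs, hnewton, Matrix.sub_mul, Matrix.trace_sub,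
      trace_inv_mul_eq_zero_of_barrier_min hZ hZmin hN hNs, sub_zero]
  have hle := trace_inv_sub_inv_mul_le hXD.1 hZ.1 hNs hclose
  rw [← hsq, pow_two] at hle
  rcases (show 0 ≤ localNorm X N from Real.sqrt_nonneg _).eq_or_lt' with h0 | hpos
  · rw [h0]
    exact div_nonneg (Real.sqrt_nonneg _) (sub_nonneg.2 hclose.le)
  · exact le_of_mul_le_mul_right hle hpos
end

section
/- Let X ∈ D satisfy ‖N(X)‖_X ≤ 1/4. Then f attains a minimizer Z over D, and ‖Z - X⁺‖_X ≤ 3‖N(X)‖_X² / (1 - ‖N(X)‖_X)³, and consequently ‖X - Z‖_X ≤ ‖N(X)‖_X + 3‖N(X)‖_X² / (1 - ‖N(X)‖_X)³. -/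
section
open Matrix
open scoped Matrix.Norms.Frobenius

theorem Matrix.PosDef.exists_isUnit_mul_transpose {n : ℕ} {C : Matrix (Fin n) (Fin n) ℝ}
    (hC : C.PosDef) : ∃ T : Matrix (Fin n) (Fin n) ℝ, IsUnit T ∧ T * Tᵀ = C := by
  open scoped ComplexOrder MatrixOrder in
  obtain ⟨y, hy, h⟩ := CStarAlgebra.isStrictlyPositive_iff_eq_star_mul_self.mp
    hC.isStrictlyPositive
  refine ⟨star y, hy.star, ?_⟩
  rw [h]
  simp [Matrix.star_eq_conjTranspose, Matrix.conjTranspose_eq_transpose_of_trivial]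

theorem Matrix.frobenius_norm_sq {n : ℕ} (A : Matrix (Fin n) (Fin n) ℝ) :
    ‖A‖ ^ 2 = (Aᵀ * A).trace := by
  rw [Matrix.frobenius_norm_def, ← Real.sqrt_eq_rpow, Real.sq_sqrt (by positivity), Finset.sum_comm]
  simp [Matrix.trace, Matrix.mul_apply, sq]

theorem Matrix.trace_mul_le_frobenius_norm {n : ℕ} (A B : Matrix (Fin n) (Fin n) ℝ) :
    (A * B).trace ≤ ‖A‖ * ‖B‖ := by
  rw [Matrix.frobenius_norm_def, Matrix.frobenius_norm_def, ← Real.sqrt_eq_rpow,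
    ← Real.sqrt_eq_rpow, Finset.sum_comm (f := fun i j => ‖B i j‖ ^ (2 : ℝ))]
  simp only [← Finset.sum_product', Finset.univ_product_univ, Matrix.trace, Matrix.mul_apply,
    Matrix.diag_apply]
  refine (Real.sum_mul_le_sqrt_mul_sqrt _ _ _).trans (le_of_eq ?_)
  simp

theorem Real.log_le_sub_one_sub_sq_div {t ρ : ℝ} (ht : 0 < t) (hρ : |t - 1| ≤ ρ) :
    Real.log t ≤ (t - 1) - (t - 1) ^ 2 / (2 * (1 + ρ)) := by
  have hρ0 : 0 ≤ ρ := (abs_nonneg _).trans hρ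
  rcases le_total 1 t with h | h
  · have h1 : Real.log t ≤ (t - t⁻¹) / 2 := by
      rw [← Real.sinh_log ht]
      exact Real.self_le_sinh_iff.2 (Real.log_nonneg h)
    have h2 : (t - t⁻¹) / 2 = (t - 1) - (t - 1) ^ 2 / (2 * t) := by field_simp; ring
    have h3 : (t - 1) ^ 2 / (2 * (1 + ρ)) ≤ (t - 1) ^ 2 / (2 * t) := by
      have := le_of_abs_le hρ
      gcongr
      linarith
    linarith
  · have h1 := Real.le_log_one_add_of_nonneg (x := t⁻¹ - 1) (by
      have := (one_le_inv₀ ht).2 h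
      linarith)
    rw [add_sub_cancel, Real.log_inv] at h1
    have h2 : 2 * (t⁻¹ - 1) / (t⁻¹ - 1 + 2) = -(t - 1) + (t - 1) ^ 2 / (1 + t) := by
      have : t⁻¹ - 1 + 2 = (1 + t) / t := by field_simp; ring
      rw [this]; field_simp; ring
    have h3 : (t - 1) ^ 2 / (2 * (1 + ρ)) ≤ (t - 1) ^ 2 / (1 + t) := by
      gcongr
      linarith
    linarith

theorem Matrix.PosDef.log_det_le {n : ℕ} {A : Matrix (Fin n) (Fin n) ℝ} (hA : A.PosDef) :
    Real.log A.det ≤ (A - 1).trace - ‖A - 1‖ ^ 2 / (2 * (1 + ‖A - 1‖)) := by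
  have hA1 : A.IsHermitian := hA.1
  have hT : Aᵀ = A := by
    rw [← Matrix.conjTranspose_eq_transpose_of_trivial]; exact hA1
  have htr : A.trace = ∑ i, hA1.eigenvalues i := by
    simpa using hA1.trace_eq_sum_eigenvalues
  have htr2 : (A * A).trace = ∑ i, hA1.eigenvalues i ^ 2 := by
    conv_lhs => rw [hA1.spectral_theorem, ← map_mul, Unitary.conjStarAlgAut_apply,
      Matrix.trace_mul_cycle]
    simp [Matrix.trace, sq]
  have hnorm : ‖A - 1‖ ^ 2 = ∑ i, (hA1.eigenvalues i - 1) ^ 2 := by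
    rw [Matrix.frobenius_norm_sq, Matrix.transpose_sub, hT, Matrix.transpose_one]
    have : (A - 1) * (A - 1) = A * A - A - A + 1 := by noncomm_ring
    rw [this]
    simp only [sub_sq, Finset.sum_add_distrib, Finset.sum_sub_distrib, Matrix.trace_add,
      Matrix.trace_sub, htr, htr2, ← Finset.sum_mul, ← Finset.mul_sum]
    simp
    ring
  have habs (i : Fin n) : |hA1.eigenvalues i - 1| ≤ ‖A - 1‖ := by
    apply abs_le_of_sq_le_sq _ (norm_nonneg _)
    rw [hnorm]
    exact Finset.single_le_sum (f := fun i => (hA1.eigenvalues i - 1) ^ 2)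
      (fun _ _ => sq_nonneg _) (Finset.mem_univ i)
  have hdet : Real.log A.det = ∑ i, Real.log (hA1.eigenvalues i) := by
    rw [hA1.det_eq_prod_eigenvalues]
    exact Real.log_prod (fun i _ => (hA.eigenvalues_pos i).ne')
  rw [hdet]
  refine (Finset.sum_le_sum fun i _ =>
    Real.log_le_sub_one_sub_sq_div (hA.eigenvalues_pos i) (habs i)).trans (le_of_eq ?_)
  rw [Finset.sum_sub_distrib, ← Finset.sum_div, ← hnorm, Matrix.trace_sub, htr]
  simp

theorem Matrix.posDef_of_frobenius_norm_sub_one_lt {n : ℕ} {A : Matrix (Fin n) (Fin n) ℝ}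
    (hA : A.IsSymm) (h : ‖A - 1‖ < 1) : A.PosDef := by
  refine Matrix.PosDef.of_dotProduct_mulVec_pos
    (by rw [Matrix.IsHermitian, Matrix.conjTranspose_eq_transpose_of_trivial]; exact hA) ?_
  intro x hx
  have hx2 : 0 < x ⬝ᵥ x := by
    simpa using (Matrix.dotProduct_star_self_pos_iff (v := x)).2 hx
  have h1 : ((1 - A) * Matrix.vecMulVec x x).trace ≤ ‖1 - A‖ * (x ⬝ᵥ x) := by
    refine (Matrix.trace_mul_le_frobenius_norm _ _).trans (le_of_eq ?_)
    congr 1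
    rw [← sq_eq_sq₀ (norm_nonneg _) hx2.le, Matrix.frobenius_norm_sq]
    simp [Matrix.transpose_vecMulVec, Matrix.vecMulVec_mul_vecMulVec, Matrix.trace_vecMulVec, sq]
  have h2 : ((1 - A) * Matrix.vecMulVec x x).trace = x ⬝ᵥ x - x ⬝ᵥ (A *ᵥ x) := by
    rw [Matrix.mul_vecMulVec, Matrix.trace_vecMulVec, Matrix.sub_mulVec, Matrix.one_mulVec,
      sub_dotProduct, dotProduct_comm (A *ᵥ x)]
  rw [h2, norm_sub_rev] at h1
  have : ‖A - 1‖ * (x ⬝ᵥ x) < x ⬝ᵥ x := by nlinarith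
  simp only [star_trivial]
  linarith

theorem Matrix.log_det_one_add_add_le {n : ℕ} {M H : Matrix (Fin n) (Fin n) ℝ}
    (hM : M.IsSymm) (hH : H.IsSymm) (hM1 : ‖M‖ < 1) (hpos : (1 + M + H).PosDef)
    (horth : ((M - 1) * H).trace = 0) :
    ∃ ρ : ℝ, ‖H‖ ≤ (1 + ‖M‖) * ρ ∧
      Real.log (1 + M + H).det ≤ Real.log (1 + M).det + ‖M‖ ^ 2 * ‖H‖ / (1 - ‖M‖)
        - ρ ^ 2 / (2 * (1 + ρ)) := by
  have hC : (1 + M).PosDef := Matrix.posDef_of_frobenius_norm_sub_one_lt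
    (Matrix.isSymm_one.add hM) (by simpa using hM1)
  obtain ⟨T, hT, hTC⟩ := hC.exists_isUnit_mul_transpose
  have hdetT : IsUnit T.det := (Matrix.isUnit_iff_isUnit_det T).1 hT
  have hTS : T * T⁻¹ = 1 := Matrix.mul_nonsing_inv T hdetT
  have hST : T⁻¹ * T = 1 := Matrix.nonsing_inv_mul T hdetT
  have hSTt : Tᵀ * T⁻¹ᵀ = 1 := by rw [← Matrix.transpose_mul, hST, Matrix.transpose_one]
  have hTSt : T⁻¹ᵀ * Tᵀ = 1 := by rw [← Matrix.transpose_mul, hTS, Matrix.transpose_one]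
  set S := T⁻¹ with hS
  have hSu : IsUnit S := ⟨⟨S, T, hST, hTS⟩, rfl⟩
  set A := S * (1 + M + H) * Sᵀ with hAdef
  have hA : A.PosDef := by
    have := (Matrix.IsUnit.posDef_star_right_conjugate_iff (x := 1 + M + H) hSu).2 hpos
    rwa [Matrix.star_eq_conjTranspose, Matrix.conjTranspose_eq_transpose_of_trivial] at this
  have hAG : A - 1 = S * H * Sᵀ := by
    have : S * (T * Tᵀ) * Sᵀ = 1 := by
      rw [← mul_assoc, hST, one_mul, hSTt]
    rw [hAdef, mul_add, add_mul, ← hTC, this]; abel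
  have hTAT : 1 + M + H = T * A * Tᵀ := by
    rw [hAdef]
    calc 1 + M + H = (T * S) * (1 + M + H) * (Sᵀ * Tᵀ) := by rw [hTS, hTSt, one_mul, mul_one]
      _ = _ := by simp only [mul_assoc]
  have hHG : H = T * (A - 1) * Tᵀ := by
    rw [hAG]
    calc H = (T * S) * H * (Sᵀ * Tᵀ) := by rw [hTS, hTSt, one_mul, mul_one]
      _ = _ := by simp only [mul_assoc]
  refine ⟨‖A - 1‖, ?_, ?_⟩
  · have hTT : ‖Tᵀ * T - 1‖ = ‖M‖ := by
      have hM' : M = T * Tᵀ - 1 := by rw [hTC]; abel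
      rw [← sq_eq_sq₀ (norm_nonneg _) (norm_nonneg _), Matrix.frobenius_norm_sq,
        Matrix.frobenius_norm_sq, hM']
      simp only [Matrix.transpose_sub, Matrix.transpose_mul, Matrix.transpose_transpose,
        Matrix.transpose_one, sub_mul, mul_sub, one_mul, mul_one, Matrix.trace_sub]
      have h1 : (Tᵀ * T * (Tᵀ * T)).trace = (T * Tᵀ * (T * Tᵀ)).trace := by
        rw [mul_assoc, Matrix.trace_mul_comm]; simp only [mul_assoc]
      rw [h1, Matrix.trace_mul_comm Tᵀ T]
    have h1 : ‖(A - 1) * (Tᵀ * T)‖ ≤ (1 + ‖M‖) * ‖A - 1‖ := by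
      have : (A - 1) * (Tᵀ * T) = (A - 1) + (A - 1) * (Tᵀ * T - 1) := by noncomm_ring
      rw [this]
      refine (norm_add_le _ _).trans ?_
      have := Matrix.frobenius_norm_mul (A - 1) (Tᵀ * T - 1)
      rw [hTT] at this
      linarith
    refine le_trans (le_of_sq_le_sq ?_ (norm_nonneg _)) h1
    rw [Matrix.frobenius_norm_sq, hH.eq]
    have h2 : (H * H).trace = ((A - 1) * (Tᵀ * T) * ((A - 1) * (Tᵀ * T))).trace := by
      conv_lhs => rw [hHG]
      rw [mul_assoc, mul_assoc, Matrix.trace_mul_comm]; simp only [mul_assoc]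
    rw [h2, sq]
    exact Matrix.trace_mul_le_frobenius_norm _ _
  · have hlog : Real.log (1 + M + H).det = Real.log (1 + M).det + Real.log A.det := by
      rw [← Real.log_mul hC.det_pos.ne' hA.det_pos.ne', hTAT, ← hTC]
      simp only [Matrix.det_mul]; congr 1; ring
    have hK : Sᵀ * S * H = H - M * (Sᵀ * S * H) := by
      have h1 : (1 + M) * (Sᵀ * S * H) = H := by
        rw [← hTC]
        calc T * Tᵀ * (Sᵀ * S * H) = T * (Tᵀ * Sᵀ) * S * H := by simp only [mul_assoc]
          _ = H := by rw [hSTt, mul_one, hTS, one_mul]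
      rw [add_mul, one_mul] at h1
      exact eq_sub_of_add_eq h1
    have htr : (A - 1).trace = (Sᵀ * S * H).trace := by
      rw [hAG, Matrix.trace_mul_comm, mul_assoc]
    set K := Sᵀ * S * H
    have hKn : ‖K‖ ≤ ‖H‖ / (1 - ‖M‖) := by
      rw [le_div_iff₀ (by linarith)]
      have h1 : ‖K‖ ≤ ‖H‖ + ‖M * K‖ := by
        conv_lhs => rw [hK]
        exact norm_sub_le _ _
      have := Matrix.frobenius_norm_mul M K
      linarith
    have hKtr : K.trace ≤ ‖M‖ ^ 2 * ‖H‖ / (1 - ‖M‖) := by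
      have h1 : K = -((M - 1) * H) + M * M * K := by
        have : M * K = M * H - M * (M * K) := by
          conv_lhs => rw [hK]
          rw [mul_sub]
        rw [sub_mul, one_mul, mul_assoc, neg_sub]
        conv_lhs => rw [hK, this]
        abel
      rw [h1, Matrix.trace_add, Matrix.trace_neg, horth, neg_zero, zero_add, mul_div_assoc]
      refine (Matrix.trace_mul_le_frobenius_norm _ _).trans ?_
      rw [sq]
      gcongr
      exact Matrix.frobenius_norm_mul _ _
    have := hA.log_det_le
    rw [hlog]
    linarith

theorem sq_mul_div_le_of_newton_radius_le {m h ρ : ℝ} (hm0 : 0 ≤ m) (hm : m ≤ 1 / 4)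
    (hr : 3 * m ^ 2 / (1 - m) ^ 3 ≤ h) (hρ : h ≤ (1 + m) * ρ) :
    m ^ 2 * h / (1 - m) ≤ ρ ^ 2 / (2 * (1 + ρ)) := by
  have hm1 : 0 < 1 - m := by linarith
  have hh : 0 ≤ h := le_trans (by positivity) hr
  have hρ0 : 0 ≤ ρ := by nlinarith
  rw [div_le_iff₀ (by positivity)] at hr
  rw [div_le_div_iff₀ hm1 (by positivity)]
  have key : 2 * m ^ 2 * (1 + m) * (1 + ρ) ≤ ρ * (1 - m) := by
    have h1 : 3 * m ^ 2 ≤ (1 + m) * ρ * (1 - m) ^ 3 := hr.trans (by gcongr)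
    have h2 : 2 * m ^ 2 * (1 + m) ≤ ρ * ((1 - m) - 2 * m ^ 2 * (1 + m)) := by
      have h3 : 2 * (1 + m) ^ 2 * (1 - m) ^ 3 ≤ 3 * ((1 - m) - 2 * m ^ 2 * (1 + m)) := by
        have h6 : (1 - m ^ 2) ^ 2 ≤ 1 := by
          apply pow_le_one₀ <;> nlinarith
        have h7 : m ^ 2 ≤ 1 / 16 := by nlinarith
        have h8 : m ^ 3 ≤ 1 / 64 := by nlinarith
        nlinarith
      have h4 : 3 * (2 * m ^ 2 * (1 + m)) ≤ ρ * (2 * (1 + m) ^ 2 * (1 - m) ^ 3) := by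
        calc 3 * (2 * m ^ 2 * (1 + m)) = 2 * (1 + m) * (3 * m ^ 2) := by ring
          _ ≤ 2 * (1 + m) * ((1 + m) * ρ * (1 - m) ^ 3) := by gcongr
          _ = _ := by ring
      have h5 := mul_le_mul_of_nonneg_left h3 hρ0
      linarith
    linarith
  calc m ^ 2 * h * (2 * (1 + ρ)) ≤ m ^ 2 * ((1 + m) * ρ) * (2 * (1 + ρ)) := by gcongr
    _ = ρ * (2 * m ^ 2 * (1 + m) * (1 + ρ)) := by ring
    _ ≤ ρ * (ρ * (1 - m)) := by gcongr
    _ = ρ ^ 2 * (1 - m) := by ring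

theorem exists_barrier_minimizer_of_newton_step_one {n : ℕ}
    (L : Submodule ℝ (Matrix (Fin n) (Fin n) ℝ)) (hL : ∀ Y ∈ L, Y.IsSymm)
    (M : Matrix (Fin n) (Fin n) ℝ) (hM : M ∈ L)
    (hNewton : ∀ Y ∈ L, ((M - 1) * Y).trace = 0) (hsmall : ‖M‖ ≤ 1 / 4) :
    ∃ Z ∈ barrierDomain L 1, (∀ W ∈ barrierDomain L 1, barrier Z ≤ barrier W) ∧
      ‖Z - (1 + M)‖ ≤ 3 * ‖M‖ ^ 2 / (1 - ‖M‖) ^ 3 := by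
  set r := 3 * ‖M‖ ^ 2 / (1 - ‖M‖) ^ 3 with hr
  have hm0 := norm_nonneg M
  have hr0 : 0 ≤ r := by
    have : 0 ≤ 1 - ‖M‖ := by linarith
    positivity
  have hr1 : r ≤ 4 / 9 := by
    rw [hr, div_le_iff₀ (pow_pos (by linarith) 3)]
    have h1 : (3 / 4 : ℝ) ^ 3 ≤ (1 - ‖M‖) ^ 3 := by
      gcongr
      linarith
    nlinarith
  set K : Set (Matrix (Fin n) (Fin n) ℝ) := {W | W - 1 ∈ L} ∩ Metric.closedBall (1 + M) r
  have hKc : IsCompact K := by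
    have : ProperSpace (Matrix (Fin n) (Fin n) ℝ) := FiniteDimensional.proper ℝ _
    refine (isCompact_closedBall _ _).inter_left ?_
    exact (Submodule.closed_of_finiteDimensional L).preimage (continuous_id.sub continuous_const)
  have hKpos : ∀ W ∈ K, W.PosDef := by
    rintro W ⟨hW, hWr⟩
    apply Matrix.posDef_of_frobenius_norm_sub_one_lt
    · simpa using (hL _ hW).add Matrix.isSymm_one
    · rw [mem_closedBall_iff_norm] at hWr
      have : W - 1 = (W - (1 + M)) + M := by abel
      rw [this]
      have := norm_add_le (W - (1 + M)) M
      linarith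
  have hcK : 1 + M ∈ K := ⟨by simpa using hM, Metric.mem_closedBall_self hr0⟩
  have hcont : ContinuousOn (barrier : Matrix (Fin n) (Fin n) ℝ → ℝ) K := by
    unfold barrier
    refine (ContinuousOn.log ?_ fun W hW => (hKpos W hW).det_pos.ne').neg
    exact (continuous_id.matrix_det).continuousOn
  obtain ⟨Z, hZK, hZ⟩ := hKc.exists_isMinOn ⟨_, hcK⟩ hcont
  refine ⟨Z, ⟨hKpos Z hZK, hZK.1⟩, ?_, mem_closedBall_iff_norm.1 hZK.2⟩
  rintro W ⟨hW, hWL⟩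
  by_cases hWr : ‖W - (1 + M)‖ ≤ r
  · exact hZ ⟨hWL, mem_closedBall_iff_norm.2 hWr⟩
  · have hH : W - (1 + M) ∈ L := by
      rw [← sub_sub]; exact L.sub_mem hWL hM
    have hadd : 1 + M + (W - (1 + M)) = W := by abel
    obtain ⟨ρ, hρ, hlog⟩ := Matrix.log_det_one_add_add_le (H := W - (1 + M)) (hL M hM) (hL _ hH)
      (by linarith) (by rwa [hadd]) (hNewton _ hH)
    have := sq_mul_div_le_of_newton_radius_le hm0 hsmall (not_le.1 hWr).le hρ
    have hZc : barrier Z ≤ barrier (1 + M) := hZ hcK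
    rw [hadd] at hlog
    refine hZc.trans ?_
    unfold barrier
    linarith

theorem localNorm_mul_transpose {n : ℕ} (T : Matrix (Fin n) (Fin n) ℝ)
    {V : Matrix (Fin n) (Fin n) ℝ} (hV : V.IsSymm) :
    localNorm (T * Tᵀ) V = ‖T⁻¹ * V * T⁻¹ᵀ‖ := by
  rw [localNorm, ← Real.sqrt_sq (norm_nonneg (T⁻¹ * V * T⁻¹ᵀ)), Matrix.frobenius_norm_sq,
    Matrix.mul_inv_rev, ← Matrix.transpose_nonsing_inv]
  congr 1
  simp only [Matrix.transpose_mul, Matrix.transpose_transpose, hV.eq]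
  rw [Matrix.trace_mul_comm (T⁻¹ * (V * T⁻¹ᵀ))]
  simp only [mul_assoc]
  rw [Matrix.trace_mul_comm T⁻¹]
  simp only [mul_assoc]
  rw [Matrix.trace_mul_comm V]
  simp only [mul_assoc]

theorem barrier_conj {n : ℕ} {S V : Matrix (Fin n) (Fin n) ℝ} (hS : IsUnit S) (hV : V.PosDef) :
    barrier (S * V * Sᵀ) = barrier V - 2 * Real.log |S.det| := by
  have hS' : S.det ≠ 0 := ((Matrix.isUnit_iff_isUnit_det S).1 hS).ne_zero
  have hdet : (S * V * Sᵀ).det = S.det ^ 2 * V.det := by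
    simp only [Matrix.det_mul, Matrix.det_transpose]; ring
  rw [barrier, barrier, hdet, Real.log_mul (pow_ne_zero 2 hS') hV.det_pos.ne', Real.log_pow,
    Real.log_abs]
  push_cast
  ring

theorem Matrix.posDef_conj_transpose_iff {n : ℕ} {S V : Matrix (Fin n) (Fin n) ℝ}
    (hS : IsUnit S) : (S * V * Sᵀ).PosDef ↔ V.PosDef := by
  rw [← Matrix.IsUnit.posDef_star_right_conjugate_iff (x := V) hS, Matrix.star_eq_conjTranspose,
    Matrix.conjTranspose_eq_transpose_of_trivial]

/-- The congruence `V ↦ S V Sᵀ` as a linear map. -/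
def Matrix.congrLinearMap {n : ℕ} (S : Matrix (Fin n) (Fin n) ℝ) :
    Matrix (Fin n) (Fin n) ℝ →ₗ[ℝ] Matrix (Fin n) (Fin n) ℝ where
  toFun V := S * V * Sᵀ
  map_add' V W := by rw [mul_add, add_mul]
  map_smul' c V := by simp

theorem newton_step_minimizer_exists_of_factorization {n : ℕ}
    (L : Submodule ℝ (Matrix (Fin n) (Fin n) ℝ)) (hL : ∀ Y ∈ L, Y.IsSymm)
    (X₀ T : Matrix (Fin n) (Fin n) ℝ) (hT : IsUnit T) (hXL : T * Tᵀ - X₀ ∈ L)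
    (N : Matrix (Fin n) (Fin n) ℝ) (hN : N ∈ L)
    (hNewton : ∀ Y ∈ L, (((T * Tᵀ)⁻¹ * N * (T * Tᵀ)⁻¹ - (T * Tᵀ)⁻¹) * Y).trace = 0)
    (hsmall : localNorm (T * Tᵀ) N ≤ 1 / 4) :
    ∃ Z ∈ barrierDomain L X₀, (∀ W ∈ barrierDomain L X₀, barrier Z ≤ barrier W) ∧
      localNorm (T * Tᵀ) (Z - (T * Tᵀ + N)) ≤
        3 * localNorm (T * Tᵀ) N ^ 2 / (1 - localNorm (T * Tᵀ) N) ^ 3 := by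
  have hdetT : IsUnit T.det := (Matrix.isUnit_iff_isUnit_det T).1 hT
  have hTS : T * T⁻¹ = 1 := Matrix.mul_nonsing_inv T hdetT
  have hST : T⁻¹ * T = 1 := Matrix.nonsing_inv_mul T hdetT
  have hSTt : Tᵀ * T⁻¹ᵀ = 1 := by rw [← Matrix.transpose_mul, hST, Matrix.transpose_one]
  have hTSt : T⁻¹ᵀ * Tᵀ = 1 := by rw [← Matrix.transpose_mul, hTS, Matrix.transpose_one]
  have hSu : IsUnit T⁻¹ := ⟨⟨T⁻¹, T, hST, hTS⟩, rfl⟩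
  have hinv : (T * Tᵀ)⁻¹ = T⁻¹ᵀ * T⁻¹ := by
    rw [Matrix.mul_inv_rev, ← Matrix.transpose_nonsing_inv]
  set φ := Matrix.congrLinearMap T⁻¹ with hφ
  have hφa (V) : φ V = T⁻¹ * V * T⁻¹ᵀ := rfl
  have hTφ (V) : T * φ V * Tᵀ = V := by
    calc T * φ V * Tᵀ = (T * T⁻¹) * V * (T⁻¹ᵀ * Tᵀ) := by rw [hφa]; simp only [mul_assoc]
      _ = V := by rw [hTS, hTSt, one_mul, mul_one]
  have hφT (V) : φ (T * V * Tᵀ) = V := by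
    calc φ (T * V * Tᵀ) = (T⁻¹ * T) * V * (Tᵀ * T⁻¹ᵀ) := by rw [hφa]; simp only [mul_assoc]
      _ = V := by rw [hST, hSTt, one_mul, mul_one]
  have hφX : φ (T * Tᵀ) = 1 := by simpa using hφT 1
  have hnorm {V} (hV : V ∈ L) : localNorm (T * Tᵀ) V = ‖φ V‖ := localNorm_mul_transpose T (hL V hV)
  rw [hnorm hN] at hsmall ⊢
  obtain ⟨Z, ⟨hZ, hZL⟩, hmin, hdist⟩ := exists_barrier_minimizer_of_newton_step_one (L.map φ)
    (by
      rintro _ ⟨Y, hY, rfl⟩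
      rw [hφa, Matrix.IsSymm, Matrix.transpose_mul, Matrix.transpose_mul,
        Matrix.transpose_transpose, (hL Y hY).eq, mul_assoc])
    (φ N) ⟨N, hN, rfl⟩
    (by
      rintro _ ⟨Y, hY, rfl⟩
      rw [← hNewton Y hY, hinv, hφa, hφa]
      simp only [sub_mul, one_mul, Matrix.trace_sub]
      congr 1
      · rw [← mul_assoc, Matrix.trace_mul_comm _ T⁻¹ᵀ]; simp only [mul_assoc]
      · rw [Matrix.trace_mul_comm _ T⁻¹ᵀ]; simp only [mul_assoc])
    hsmall
  have hZX : T * Z * Tᵀ - T * Tᵀ ∈ L := by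
    obtain ⟨Y, hY, hYZ⟩ := hZL
    have : Y = T * Z * Tᵀ - T * Tᵀ := by
      rw [← hTφ Y, hYZ, mul_sub, sub_mul, mul_one]
    rwa [← this]
  refine ⟨T * Z * Tᵀ, ⟨(Matrix.posDef_conj_transpose_iff hT).2 hZ, ?_⟩, ?_, ?_⟩
  · simpa using L.add_mem hZX hXL
  · rintro W ⟨hW, hWL⟩
    have hφW : (φ W).PosDef := (Matrix.posDef_conj_transpose_iff hSu).2 hW
    have h1 := hmin (φ W) ⟨hφW, W - T * Tᵀ, by simpa using L.sub_mem hWL hXL, by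
      rw [map_sub, hφX]⟩
    rw [← hTφ W, barrier_conj hT hZ, barrier_conj hT hφW]
    linarith
  · rw [← sub_sub, hnorm (L.sub_mem hZX hN), map_sub, map_sub, hφT, hφX, sub_sub]
    exact hdist

theorem localNorm_sub_le_add {n : ℕ} {X Z N : Matrix (Fin n) (Fin n) ℝ} (hX : X.PosDef)
    (hZ : (Z - (X + N)).IsSymm) (hN : N.IsSymm) :
    localNorm X (X - Z) ≤ localNorm X N + localNorm X (Z - (X + N)) := by
  obtain ⟨T, -, hT⟩ := hX.exists_isUnit_mul_transpose
  have hXZ : X - Z = -(N + (Z - (X + N))) := by abel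
  rw [hXZ, ← hT, localNorm_mul_transpose T (hN.add (hT ▸ hZ)).neg, localNorm_mul_transpose T hN,
    localNorm_mul_transpose T (hT ▸ hZ), mul_neg, neg_mul, norm_neg, mul_add, add_mul]
  exact norm_add_le _ _

end

/-- Renegar's Theorem 2.2.5 for the SDP barrier: if `X ∈ D` has Newton step `N`
(characterized by `π_L(X⁻¹ N X⁻¹) = π_L(X⁻¹)`) with `‖N‖_X ≤ 1/4`, then `f = -ln det`
attains a minimizer `Z` over `D` with `‖Z - X⁺‖_X ≤ 3‖N‖_X²/(1 - ‖N‖_X)³` for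
`X⁺ = X + N`, and consequently `‖X - Z‖_X ≤ ‖N‖_X + 3‖N‖_X²/(1 - ‖N‖_X)³`. -/
theorem newton_step_minimizer_exists {n : ℕ}
    (L : Submodule ℝ (Matrix (Fin n) (Fin n) ℝ)) (hL : ∀ Y ∈ L, Y.IsSymm)
    (X₀ : Matrix (Fin n) (Fin n) ℝ) (hX₀ : X₀.PosDef)
    (X : Matrix (Fin n) (Fin n) ℝ) (hXD : X ∈ barrierDomain L X₀)
    (N : Matrix (Fin n) (Fin n) ℝ) (hN : N ∈ L)
    (hNewton : ∀ Y ∈ L, ((X⁻¹ * N * X⁻¹ - X⁻¹) * Y).trace = 0)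
    (hsmall : localNorm X N ≤ 1 / 4) :
    ∃ Z ∈ barrierDomain L X₀, (∀ W ∈ barrierDomain L X₀, barrier Z ≤ barrier W) ∧
      localNorm X (Z - (X + N)) ≤
        3 * localNorm X N ^ 2 / (1 - localNorm X N) ^ 3 ∧
      localNorm X (X - Z) ≤
        localNorm X N + 3 * localNorm X N ^ 2 / (1 - localNorm X N) ^ 3 := by
  obtain ⟨T, hT, rfl⟩ := hXD.1.exists_isUnit_mul_transpose
  obtain ⟨Z, hZ, hmin, hdist⟩ := newton_step_minimizer_exists_of_factorization L hL X₀ T hT hXD.2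
    N hN hNewton hsmall
  refine ⟨Z, hZ, hmin, hdist, (localNorm_sub_le_add hXD.1 (hL _ ?_) (hL N hN)).trans (by gcongr)⟩
  have : Z - (T * T.transpose + N) = (Z - X₀) - (T * T.transpose - X₀) - N := by abel
  rw [this]
  exact L.sub_mem (L.sub_mem hZ.2 hXD.2) hN
end
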